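/- The formal power series G(x) = ∑_{n≥0} f_{321}(S_n(123,132,213)) x^n (whose coefficients vanish for n < 3) satisfies the identity (1 − x − x²)⁴ · G(x) = x³(1 + 6x + 12x² + 8x³) in ℤ⟦x⟧. -/

import Mathlib

open Finset

/-- Number of occurrences of the length-3 pattern `q` (given by its sequence of values)
in the permutation `σ` of `Fin n`: triples of indices `ι 0 < ι 1 < ι 2` whose values under
`σ` are in the same relative order as the values of `q`. -/
def occ (n : ℕ) (q : Fin 3 → ℕ) (σ : Equiv.Perm (Fin n)) : ℕ :=
  (Finset.univ.filter fun ι : Fin 3 → Fin n =>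
    (∀ j l : Fin 3, j < l → ι j < ι l) ∧
    (∀ j l : Fin 3, q j < q l ↔ σ (ι j) < σ (ι l))).card

/-- The set `S_n(R)` of permutations of `{1,…,n}` avoiding every pattern in `R`. -/
def avoiders (n : ℕ) (R : List (Fin 3 → ℕ)) : Finset (Equiv.Perm (Fin n)) :=
  Finset.univ.filter fun σ => ∀ q ∈ R, occ n q σ = 0

/-- `f_q(S_n(R))`: the total number of occurrences of the pattern `q` among
all permutations in `S_n(R)`. -/
def fCnt (n : ℕ) (q : Fin 3 → ℕ) (R : List (Fin 3 → ℕ)) : ℕ :=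
  ∑ σ ∈ avoiders n R, occ n q σ

def p123 : Fin 3 → ℕ := ![1, 2, 3]
def p132 : Fin 3 → ℕ := ![1, 3, 2]
def p213 : Fin 3 → ℕ := ![2, 1, 3]
def p231 : Fin 3 → ℕ := ![2, 3, 1]
def p312 : Fin 3 → ℕ := ![3, 1, 2]
def p321 : Fin 3 → ℕ := ![3, 2, 1]

open Equiv

/-- Permutations whose values increase along any two positions at distance at least two. -/
def sparselyIncreasing (n : ℕ) : Finset (Perm (Fin n)) :=
  Finset.univ.filter fun τ => ∀ i j k : Fin n, i < j → j < k → τ i < τ k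

/-- The increasing subsequences of length `k` of `τ`. -/
def incSubseq {n : ℕ} (k : ℕ) (τ : Perm (Fin n)) : Finset (Fin k → Fin n) :=
  Finset.univ.filter fun ι => ∀ j l, j < l → ι j < ι l ∧ τ (ι j) < τ (ι l)

/-- The total number of increasing subsequences of length `k` in `sparselyIncreasing n`. -/
def totalInc (k n : ℕ) : ℕ := ∑ τ ∈ sparselyIncreasing n, (incSubseq k τ).card

/-- Prepend a fixed point to a permutation. -/
def consFixed {n : ℕ} (σ : Perm (Fin n)) : Perm (Fin (n + 1)) := Perm.decomposeFin.symm (0, σ)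

/-- Prepend a transposition of two adjacent points to a permutation. -/
def consSwap {n : ℕ} (σ : Perm (Fin n)) : Perm (Fin (n + 2)) :=
  Perm.decomposeFin.symm (1, consFixed σ)

@[simp] lemma consFixed_zero {n : ℕ} (σ : Perm (Fin n)) : consFixed σ 0 = 0 := by
  simp [consFixed]

@[simp] lemma consFixed_succ {n : ℕ} (σ : Perm (Fin n)) (i : Fin n) :
    consFixed σ i.succ = (σ i).succ := by
  simp [consFixed]

@[simp] lemma consSwap_zero {n : ℕ} (σ : Perm (Fin n)) : consSwap σ 0 = 1 := by
  simp [consSwap]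

@[simp] lemma consSwap_one {n : ℕ} (σ : Perm (Fin n)) : consSwap σ 1 = 0 := by
  rw [← Fin.succ_zero_eq_one, consSwap, Perm.decomposeFin_symm_apply_succ, consFixed_zero]
  simp

@[simp] lemma consSwap_succ_succ {n : ℕ} (σ : Perm (Fin n)) (i : Fin n) :
    consSwap σ i.succ.succ = (σ i).succ.succ := by
  rw [consSwap, Perm.decomposeFin_symm_apply_succ, consFixed_succ]
  apply swap_apply_of_ne_of_ne <;> simp [Fin.ext_iff]

lemma consFixed_injective {n : ℕ} : Function.Injective (consFixed (n := n)) := fun a b h => by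
  simpa [consFixed] using h

lemma consSwap_injective {n : ℕ} : Function.Injective (consSwap (n := n)) := fun a b h => by
  apply consFixed_injective
  simpa [consSwap] using h

lemma consFixed_mem {n : ℕ} {σ : Perm (Fin n)} :
    consFixed σ ∈ sparselyIncreasing (n + 1) ↔ σ ∈ sparselyIncreasing n := by
  simp only [sparselyIncreasing, mem_filter, mem_univ, true_and]
  constructor
  · intro h i j k hij hjk
    simpa using h i.succ j.succ k.succ (by simpa) (by simpa)
  · intro h i j k hij hjk
    cases k using Fin.cases with
    | zero => simp at hjk
    | succ k =>
      cases j using Fin.cases with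
      | zero => simp at hij
      | succ j =>
        cases i using Fin.cases with
        | zero => simp
        | succ i => simpa using h i j k (by simpa using hij) (by simpa using hjk)

lemma consSwap_mem {n : ℕ} {σ : Perm (Fin n)} :
    consSwap σ ∈ sparselyIncreasing (n + 2) ↔ σ ∈ sparselyIncreasing n := by
  simp only [sparselyIncreasing, mem_filter, mem_univ, true_and]
  constructor
  · intro h i j k hij hjk
    simpa using h i.succ.succ j.succ.succ k.succ.succ (by simpa) (by simpa)
  · intro h i j k hij hjk
    obtain ⟨k, rfl⟩ : ∃ k' : Fin n, k = k'.succ.succ :=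
      ⟨⟨k - 2, by omega⟩, by ext; simp; omega⟩
    rw [consSwap_succ_succ]
    cases i using Fin.cases with
    | zero => simp [Fin.lt_def]
    | succ i =>
      cases i using Fin.cases with
      | zero => simp
      | succ i =>
        obtain ⟨j, rfl⟩ : ∃ j' : Fin n, j = j'.succ.succ := by
          have : 2 < (j : ℕ) := by
            have := Fin.lt_def.mp hij
            simp at this
            omega
          exact ⟨⟨j - 2, by omega⟩, by ext; simp; omega⟩
        simpa using h i j k (by simpa using hij) (by simpa using hjk)

lemma eq_consFixed {n : ℕ} (τ : Perm (Fin (n + 1))) (h : τ 0 = 0) : ∃ σ, τ = consFixed σ := by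
  obtain ⟨⟨p, σ⟩, rfl⟩ := Perm.decomposeFin.symm.surjective τ
  refine ⟨σ, ?_⟩
  rw [Perm.decomposeFin_symm_apply_zero] at h
  rw [h, consFixed]

lemma eq_consSwap {n : ℕ} (τ : Perm (Fin (n + 2))) (h0 : τ 0 = 1) (h1 : τ 1 = 0) :
    ∃ σ, τ = consSwap σ := by
  obtain ⟨⟨p, e⟩, rfl⟩ := Perm.decomposeFin.symm.surjective τ
  rw [Perm.decomposeFin_symm_apply_zero] at h0
  subst h0
  rw [← Fin.succ_zero_eq_one, Perm.decomposeFin_symm_apply_succ, swap_apply_eq_iff,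
    swap_apply_left] at h1
  obtain ⟨σ, rfl⟩ := eq_consFixed e (Fin.succ_injective _ h1)
  exact ⟨σ, by rw [consSwap]⟩

lemma one_lt_iff_ne {n : ℕ} {a : Fin (n + 2)} : 1 < a ↔ a ≠ 0 ∧ a ≠ 1 := by
  simp only [Fin.lt_def, ne_eq, Fin.ext_iff, Fin.val_zero, Fin.val_one]
  omega

lemma exists_consFixed_or_consSwap {n : ℕ} {τ : Perm (Fin (n + 2))}
    (h : τ ∈ sparselyIncreasing (n + 2)) : (∃ σ, τ = consFixed σ) ∨ ∃ σ, τ = consSwap σ := by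
  simp only [sparselyIncreasing, mem_filter, mem_univ, true_and] at h
  have key : ∀ k, τ k < τ 0 → k = 1 := by
    intro k hk
    by_contra hne
    have h0 : k ≠ 0 := by rintro rfl; exact lt_irrefl _ hk
    exact lt_asymm hk (h 0 1 k (by simp) (one_lt_iff_ne.mpr ⟨h0, hne⟩))
  by_cases h0 : τ 0 = 0
  · exact Or.inl (eq_consFixed τ h0)
  · right
    have h1 : τ 1 = 0 := by
      have := key (τ.symm 0) (by simpa [Fin.pos_iff_ne_zero] using h0)
      rw [← this, apply_symm_apply]
    refine eq_consSwap τ ?_ h1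
    by_contra hne
    have : τ.symm 1 = 1 := key _ (by
      rw [apply_symm_apply]
      exact one_lt_iff_ne.mpr ⟨h0, hne⟩)
    rw [symm_apply_eq, h1] at this
    simp at this

lemma sparselyIncreasing_add_two (n : ℕ) :
    sparselyIncreasing (n + 2) =
      (sparselyIncreasing (n + 1)).image consFixed ∪ (sparselyIncreasing n).image consSwap := by
  ext τ
  simp only [mem_union, mem_image]
  constructor
  · intro h
    rcases exists_consFixed_or_consSwap h with ⟨σ, rfl⟩ | ⟨σ, rfl⟩
    · exact Or.inl ⟨σ, consFixed_mem.mp h, rfl⟩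
    · exact Or.inr ⟨σ, consSwap_mem.mp h, rfl⟩
  · rintro (⟨σ, h, rfl⟩ | ⟨σ, h, rfl⟩)
    · exact consFixed_mem.mpr h
    · exact consSwap_mem.mpr h

lemma sparselyIncreasing_one :
    sparselyIncreasing 1 = (sparselyIncreasing 0).image consFixed := by
  ext τ
  have h : τ = consFixed 1 := Subsingleton.elim _ _
  simp only [mem_image]
  constructor
  · intro hm
    exact ⟨1, consFixed_mem.mp (h ▸ hm), h.symm⟩
  · rintro ⟨σ, hm, rfl⟩
    exact consFixed_mem.mpr hm

lemma sum_sparselyIncreasing_add_two {n : ℕ} (f : Perm (Fin (n + 2)) → ℕ) :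
    ∑ τ ∈ sparselyIncreasing (n + 2), f τ =
      ∑ σ ∈ sparselyIncreasing (n + 1), f (consFixed σ) +
        ∑ σ ∈ sparselyIncreasing n, f (consSwap σ) := by
  rw [sparselyIncreasing_add_two, sum_union, sum_image consFixed_injective.injOn,
    sum_image consSwap_injective.injOn]
  rw [disjoint_left]
  simp only [mem_image]
  rintro _ ⟨σ, -, rfl⟩ ⟨σ', -, h⟩
  simpa using congrArg (fun τ => τ 0) h

lemma mem_incSubseq {n k : ℕ} {τ : Perm (Fin n)} {ι : Fin k → Fin n} :
    ι ∈ incSubseq k τ ↔ ∀ j l, j < l → ι j < ι l ∧ τ (ι j) < τ (ι l) := by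
  simp [incSubseq]

lemma card_incSubseq_zero {n : ℕ} (τ : Perm (Fin n)) : (incSubseq 0 τ).card = 1 := by
  simp [incSubseq]

lemma cons_mem_incSubseq {n k : ℕ} {τ : Perm (Fin n)} {a : Fin n} {ι : Fin k → Fin n} :
    (Fin.cons a ι : Fin (k + 1) → Fin n) ∈ incSubseq (k + 1) τ ↔
      (∀ j, a < ι j ∧ τ a < τ (ι j)) ∧ ι ∈ incSubseq k τ := by
  simp [mem_incSubseq, Fin.forall_fin_succ]

lemma succ_comp_mem_incSubseq {n k : ℕ} {σ : Perm (Fin n)} {ι : Fin k → Fin n} :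
    Fin.succ ∘ ι ∈ incSubseq k (consFixed σ) ↔ ι ∈ incSubseq k σ := by
  simp [mem_incSubseq]

lemma succ_succ_comp_mem_incSubseq {n k : ℕ} {σ : Perm (Fin n)} {ι : Fin k → Fin n} :
    (fun j => (ι j).succ.succ) ∈ incSubseq k (consSwap σ) ↔ ι ∈ incSubseq k σ := by
  simp [mem_incSubseq]

lemma exists_succ_comp {n k : ℕ} (ι : Fin k → Fin (n + 1)) (h : ∀ j, 0 < ι j) :
    ∃ ι' : Fin k → Fin n, ι = Fin.succ ∘ ι' :=
  ⟨fun j => (ι j).pred (h j).ne', by ext; simp⟩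

lemma exists_succ_succ_comp {n k : ℕ} (ι : Fin k → Fin (n + 2)) (h : ∀ j, 1 < ι j) :
    ∃ ι' : Fin k → Fin n, ι = fun j => (ι' j).succ.succ := by
  refine ⟨fun j => ⟨ι j - 2, ?_⟩, ?_⟩
  · have := Fin.lt_def.mp (h j)
    simp at this
    omega
  · ext j
    have := Fin.lt_def.mp (h j)
    simp at this ⊢
    omega

lemma incSubseq_consFixed {n : ℕ} (k : ℕ) (σ : Perm (Fin n)) :
    incSubseq (k + 1) (consFixed σ) =
      (incSubseq (k + 1) σ).image (Fin.succ ∘ ·) ∪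
        (incSubseq k σ).image (fun ι => Fin.cons 0 (Fin.succ ∘ ι)) := by
  ext ι
  simp only [mem_union, mem_image]
  constructor
  · intro h
    have hlt := mem_incSubseq.mp h
    by_cases h0 : ι 0 = 0
    · right
      obtain ⟨ι', hι⟩ := exists_succ_comp (Fin.tail ι) (fun j => by
        simpa [h0, Fin.tail] using (hlt 0 j.succ (by simp)).1)
      rw [← Fin.cons_self_tail ι, hι, h0, cons_mem_incSubseq, succ_comp_mem_incSubseq] at h
      exact ⟨ι', h.2, by rw [← hι, ← h0, Fin.cons_self_tail]⟩
    · left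
      obtain ⟨ι', rfl⟩ := exists_succ_comp ι (fun j => by
        cases j using Fin.cases with
        | zero => exact Fin.pos_iff_ne_zero.mpr h0
        | succ j => exact lt_of_le_of_lt (Fin.zero_le _) (hlt 0 j.succ (by simp)).1)
      exact ⟨ι', succ_comp_mem_incSubseq.mp h, rfl⟩
  · rintro (⟨ι, h, rfl⟩ | ⟨ι, h, rfl⟩)
    · exact succ_comp_mem_incSubseq.mpr h
    · rw [cons_mem_incSubseq, succ_comp_mem_incSubseq]
      exact ⟨by simp, h⟩

lemma card_incSubseq_consFixed {n : ℕ} (k : ℕ) (σ : Perm (Fin n)) :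
    (incSubseq (k + 1) (consFixed σ)).card =
      (incSubseq (k + 1) σ).card + (incSubseq k σ).card := by
  rw [incSubseq_consFixed, card_union_of_disjoint, card_image_of_injective,
    card_image_of_injective]
  · intro a b h
    exact (Fin.succ_injective n).comp_left (Fin.cons_right_injective _ h)
  · exact (Fin.succ_injective n).comp_left
  · rw [disjoint_left]
    simp only [mem_image]
    rintro _ ⟨a, -, rfl⟩ ⟨b, -, h⟩
    exact (Fin.succ_ne_zero (a 0)).symm (by simpa using congrFun h 0)

lemma incSubseq_consSwap {n : ℕ} (k : ℕ) (σ : Perm (Fin n)) :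
    incSubseq (k + 1) (consSwap σ) =
      (incSubseq (k + 1) σ).image (fun ι j => (ι j).succ.succ) ∪
        ((incSubseq k σ).image (fun ι => Fin.cons 0 (fun j => (ι j).succ.succ)) ∪
          (incSubseq k σ).image (fun ι => Fin.cons 1 (fun j => (ι j).succ.succ))) := by
  ext ι
  simp only [mem_union, mem_image]
  constructor
  · intro h
    have hlt := mem_incSubseq.mp h
    by_cases h0 : ι 0 = 0 ∨ ι 0 = 1
    · right
      obtain ⟨ι', hι⟩ := exists_succ_succ_comp (Fin.tail ι) (fun j => by
        have hj := hlt 0 j.succ (by simp)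
        rcases h0 with h0 | h0
        · rw [h0] at hj
          have h1 : ι j.succ ≠ 1 := fun h1 => by
            rw [h1] at hj
            simp at hj
          exact one_lt_iff_ne.mpr ⟨hj.1.ne', h1⟩
        · rw [h0] at hj
          exact hj.1)
      rw [← Fin.cons_self_tail ι, hι, cons_mem_incSubseq, succ_succ_comp_mem_incSubseq] at h
      rcases h0 with h0 | h0
      · exact Or.inl ⟨ι', h.2, by rw [← hι, ← h0, Fin.cons_self_tail]⟩
      · exact Or.inr ⟨ι', h.2, by rw [← hι, ← h0, Fin.cons_self_tail]⟩
    · left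
      have h1 : 1 < ι 0 := one_lt_iff_ne.mpr (not_or.mp h0)
      obtain ⟨ι', rfl⟩ := exists_succ_succ_comp ι (fun j => by
        cases j using Fin.cases with
        | zero => exact h1
        | succ j => exact h1.trans (hlt 0 j.succ (by simp)).1)
      exact ⟨ι', succ_succ_comp_mem_incSubseq.mp h, rfl⟩
  · rintro (⟨ι, h, rfl⟩ | ⟨ι, h, rfl⟩ | ⟨ι, h, rfl⟩)
    · exact succ_succ_comp_mem_incSubseq.mpr h
    · rw [cons_mem_incSubseq, succ_succ_comp_mem_incSubseq]
      exact ⟨by simp [Fin.lt_def], h⟩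
    · rw [cons_mem_incSubseq, succ_succ_comp_mem_incSubseq]
      exact ⟨by simp [Fin.lt_def], h⟩

lemma card_incSubseq_consSwap {n : ℕ} (k : ℕ) (σ : Perm (Fin n)) :
    (incSubseq (k + 1) (consSwap σ)).card =
      (incSubseq (k + 1) σ).card + 2 * (incSubseq k σ).card := by
  have hinj (m : ℕ) : Function.Injective
      (fun (ι : Fin m → Fin n) (j : Fin m) => (ι j).succ.succ) :=
    ((Fin.succ_injective _).comp (Fin.succ_injective n)).comp_left
  rw [incSubseq_consSwap, card_union_of_disjoint, card_union_of_disjoint,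
    card_image_of_injective _ (hinj _), card_image_of_injective, card_image_of_injective, two_mul]
  · exact fun a b h => hinj k (Fin.cons_right_injective _ h)
  · exact fun a b h => hinj k (Fin.cons_right_injective _ h)
  · rw [disjoint_left]
    simp only [mem_image]
    rintro _ ⟨a, -, rfl⟩ ⟨b, -, h⟩
    simpa using congrFun h 0
  · rw [disjoint_left]
    simp only [mem_image, mem_union]
    rintro _ ⟨a, -, rfl⟩ (⟨b, -, h⟩ | ⟨b, -, h⟩) <;> simpa [Fin.ext_iff] using congrFun h 0

lemma totalInc_succ_add_two (k n : ℕ) :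
    totalInc (k + 1) (n + 2) =
      totalInc (k + 1) (n + 1) + totalInc k (n + 1) + (totalInc (k + 1) n + 2 * totalInc k n) := by
  simp only [totalInc, sum_sparselyIncreasing_add_two, card_incSubseq_consFixed,
    card_incSubseq_consSwap, sum_add_distrib, mul_sum]

lemma totalInc_zero_add_two (n : ℕ) :
    totalInc 0 (n + 2) = totalInc 0 (n + 1) + totalInc 0 n := by
  simp only [totalInc, sum_sparselyIncreasing_add_two, card_incSubseq_zero]

lemma totalInc_succ_zero (k : ℕ) : totalInc (k + 1) 0 = 0 := by
  simp [totalInc, incSubseq]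

lemma totalInc_succ_one (k : ℕ) : totalInc (k + 1) 1 = totalInc k 0 := by
  rw [totalInc, sparselyIncreasing_one, sum_image consFixed_injective.injOn]
  simp only [card_incSubseq_consFixed, sum_add_distrib]
  change totalInc (k + 1) 0 + totalInc k 0 = _
  rw [totalInc_succ_zero, zero_add]

lemma totalInc_zero_zero : totalInc 0 0 = 1 := by
  simp [totalInc, card_incSubseq_zero, sparselyIncreasing]

lemma totalInc_zero_one : totalInc 0 1 = 1 := by
  rw [totalInc, sparselyIncreasing_one, sum_image consFixed_injective.injOn]
  simp [card_incSubseq_zero, sparselyIncreasing]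

/-- The generating function of `totalInc k`. -/
noncomputable def incSeries (k : ℕ) : PowerSeries ℤ := PowerSeries.mk fun n => (totalInc k n : ℤ)

lemma incSeries_zero :
    incSeries 0 = 1 + PowerSeries.X * incSeries 0 +
      PowerSeries.X * (PowerSeries.X * incSeries 0) := by
  ext n
  rcases n with _ | _ | n
  · simp [incSeries, totalInc_zero_zero]
  · simp [incSeries, PowerSeries.coeff_succ_X_mul, PowerSeries.coeff_one, totalInc_zero_zero,
      totalInc_zero_one]
  · simp [incSeries, PowerSeries.coeff_succ_X_mul, PowerSeries.coeff_one, totalInc_zero_add_two]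

lemma incSeries_succ (k : ℕ) :
    incSeries (k + 1) = PowerSeries.X * (incSeries (k + 1) + incSeries k) +
      PowerSeries.X * (PowerSeries.X * (incSeries (k + 1) + (incSeries k + incSeries k))) := by
  ext n
  rcases n with _ | _ | n
  · simp [incSeries, totalInc_succ_zero]
  · simp [incSeries, PowerSeries.coeff_succ_X_mul, totalInc_succ_zero, totalInc_succ_one]
  · simp [incSeries, PowerSeries.coeff_succ_X_mul, totalInc_succ_add_two]
    ring

lemma occ_p321 {n : ℕ} (σ : Perm (Fin n)) :
    occ n p321 σ = (incSubseq 3 (σ.trans Fin.revPerm)).card := by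
  unfold occ incSubseq
  congr 1
  ext ι
  rw [mem_filter, mem_filter]
  simp [Fin.forall_fin_succ, p321]
  grind

lemma occ_eq_zero_iff {n : ℕ} {q : Fin 3 → ℕ} {σ : Perm (Fin n)} :
    occ n q σ = 0 ↔ ∀ ι : Fin 3 → Fin n, (∀ j l : Fin 3, j < l → ι j < ι l) →
      ¬ ∀ j l : Fin 3, q j < q l ↔ σ (ι j) < σ (ι l) := by
  simp only [occ, card_eq_zero, filter_eq_empty_iff, mem_univ, forall_true_left, not_and]

lemma mem_avoiders {n : ℕ} {σ : Perm (Fin n)} :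
    σ ∈ avoiders n [p123, p132, p213] ↔ σ.trans Fin.revPerm ∈ sparselyIncreasing n := by
  simp only [avoiders, sparselyIncreasing, mem_filter, mem_univ, true_and, List.forall_mem_cons,
    occ_eq_zero_iff]
  simp only [trans_apply, Fin.revPerm_apply, Fin.rev_lt_rev]
  constructor
  · rintro ⟨h1, h2, h3, -⟩ i j k hij hjk
    by_contra hik
    have hne1 : σ i ≠ σ j := σ.injective.ne hij.ne
    have hne2 : σ j ≠ σ k := σ.injective.ne hjk.ne
    have hne3 : σ i ≠ σ k := σ.injective.ne (hij.trans hjk).ne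
    have hι : ∀ a b : Fin 3, a < b → ![i, j, k] a < ![i, j, k] b := by
      simp [Fin.forall_fin_succ, hij, hjk, hij.trans hjk]
    have h1 := h1 ![i, j, k] hι
    have h2 := h2 ![i, j, k] hι
    have h3 := h3 ![i, j, k] hι
    simp [Fin.forall_fin_succ, p123, p132, p213] at h1 h2 h3
    grind
  · intro h
    refine ⟨?_, ?_, ?_, by simp⟩ <;>
    · intro ι hι hq
      have h1 := h (ι 0) (ι 1) (ι 2) (hι 0 1 (by decide)) (hι 1 2 (by decide))
      exact lt_asymm h1 ((hq 0 2).mp (by decide))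

lemma fCnt_eq_totalInc (n : ℕ) : fCnt n p321 [p123, p132, p213] = totalInc 3 n :=
  sum_equiv (Equiv.mulLeft (Fin.revPerm : Perm (Fin n))) (fun _ => mem_avoiders)
    (fun σ _ => occ_p321 σ)

/-- Second part of Theorem `Tta1`: the generating function
`G(x) = ∑_n f_{321}(S_n(123,132,213)) xⁿ` equals `x³(1+6x+12x²+8x³)/(1−x−x²)⁴`, i.e.
`(1−x−x²)⁴·G(x) = x³(1+6x+12x²+8x³)` in `ℤ⟦x⟧`. -/
theorem stmt_13 :
    ((1 : PowerSeries ℤ) - PowerSeries.X - PowerSeries.X ^ 2) ^ 4 *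
        PowerSeries.mk (fun n => (fCnt n p321 [p123, p132, p213] : ℤ)) =
      PowerSeries.X ^ 3 *
        (1 + 6 * PowerSeries.X + 12 * PowerSeries.X ^ 2 + 8 * PowerSeries.X ^ 3) := by
  simp only [fCnt_eq_totalInc]
  change _ * incSeries 3 = _
  have h0 := incSeries_zero
  have h1 := incSeries_succ 0
  have h2 := incSeries_succ 1
  have h3 := incSeries_succ 2
  norm_num at h1 h2 h3
  set x : PowerSeries ℤ := PowerSeries.X
  linear_combination (1 - x - x ^ 2) ^ 3 * h3 + (1 - x - x ^ 2) ^ 2 * (x + 2 * x ^ 2) * h2 +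
    (1 - x - x ^ 2) * (x + 2 * x ^ 2) ^ 2 * h1 + (x + 2 * x ^ 2) ^ 3 * h0
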